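/- arXiv:2105.01040 — 14 statements merged into one kernel-verified Lean document; each statement's English description precedes it below -/
import Mathlib

section
/- There exists v̄ ∈ (0,1] such that for every v_B ∈ [0, v̄] and every λ ∈ [0,1] there exists h* ∈ [1/2,1] with the following property: the high-quality firm's equilibrium profit M(h) = max{C1(h), C2(h), C3(h), C4(h), C5(h)} is strictly decreasing in h on [1/2, h*] and strictly increasing in h on [h*, 1]. -/
open Set

noncomputable def W1 (vB h : ℝ) : ℝ := 1 - h + h * vB
noncomputable def W2 (vB h : ℝ) : ℝ := (3 - 2*h)/4 + ((1 + 2*h)/4) * vB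
noncomputable def W3 (vB : ℝ) : ℝ := (1 + vB)/2
noncomputable def W4 (vB h : ℝ) : ℝ := (1 + 2*h)/4 + ((3 - 2*h)/4) * vB
noncomputable def W5 (vB h : ℝ) : ℝ := h + (1 - h) * vB

/-- The high-quality firm's equilibrium (maximal pooling) profit: the maximum of the
candidate profits at the five willingness-to-pay prices. -/
noncomputable def Mprof (vB lam h : ℝ) : ℝ :=
  max (max (max (max (W1 vB h) (W2 vB h * (1 - ((1 - h)/2) * lam)))
    (W3 vB * ((1 + 2*h + lam)/4))) (W4 vB h * ((1 + 2*h - lam)/4)))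
    (W5 vB h * ((h/2) * lam))

/-- The maximum of a strictly decreasing and a strictly increasing continuous function on a
compact interval is V-shaped. -/
theorem exists_strictAntiOn_strictMonoOn_max {a b : ℝ} (hab : a ≤ b) {f g : ℝ → ℝ}
    (hf : StrictAntiOn f (Icc a b)) (hg : StrictMonoOn g (Icc a b))
    (hfc : ContinuousOn f (Icc a b)) (hgc : ContinuousOn g (Icc a b)) :
    ∃ c ∈ Icc a b, StrictAntiOn (fun x => max (f x) (g x)) (Icc a c) ∧
      StrictMonoOn (fun x => max (f x) (g x)) (Icc c b) := by
  obtain ⟨c, hc, hle, hge⟩ : ∃ c ∈ Icc a b, (c = a ∨ g c ≤ f c) ∧ (c = b ∨ f c ≤ g c) := by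
    rcases le_total (f a) (g a) with ha | ha
    · exact ⟨a, left_mem_Icc.2 hab, .inl rfl, .inr ha⟩
    rcases le_total (g b) (f b) with hb | hb
    · exact ⟨b, right_mem_Icc.2 hab, .inr hb, .inl rfl⟩
    obtain ⟨c, hc, hfg⟩ := intermediate_value_Icc hab (hgc.sub hfc)
      (show (0 : ℝ) ∈ Icc (g a - f a) (g b - f b) from ⟨by linarith, by linarith⟩)
    have heq : g c = f c := sub_eq_zero.1 hfg
    exact ⟨c, hc, .inr heq.le, .inr heq.ge⟩
  refine ⟨c, hc, ?_, ?_⟩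
  · rcases hle with rfl | hle
    · simp
    have hsub : Icc a c ⊆ Icc a b := Icc_subset_Icc_right hc.2
    refine (hf.mono hsub).congr fun x hx => (max_eq_left ?_).symm
    exact (hg.monotoneOn (hsub hx) hc hx.2).trans (hle.trans (hf.antitoneOn (hsub hx) hc hx.2))
  · rcases hge with rfl | hge
    · simp
    have hsub : Icc c b ⊆ Icc a b := Icc_subset_Icc_left hc.1
    refine (hg.mono hsub).congr fun x hx => (max_eq_right ?_).symm
    exact (hf.antitoneOn hc (hsub hx) hx.1).trans (hge.trans (hg.monotoneOn hc (hsub hx) hx.1))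

theorem W1_strictAnti {vB : ℝ} (h1 : vB < 1) : StrictAnti (W1 vB) := by
  intro x y hxy
  unfold W1
  nlinarith

/-- The profit at the price `W2` decreases in the precision when `vB` is small. -/
theorem W2_profit_strictAntiOn {vB lam : ℝ} (h0 : 0 ≤ vB) (h1 : vB ≤ 1/8)
    (hl : lam ∈ Icc (0:ℝ) 1) :
    StrictAntiOn (fun h => W2 vB h * (1 - ((1 - h)/2) * lam)) (Icc (1/2) 1) := by
  rintro x ⟨hx, hx'⟩ y ⟨hy, hy'⟩ hxy
  obtain ⟨hl0, hl1⟩ := hl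
  have key : 0 < 2 * (1 - vB) * (2 - lam + lam * (x + y)) - lam * (3 + vB) := by
    nlinarith [mul_nonneg hl0 (show 0 ≤ x + y - 1 by linarith),
      mul_nonneg (mul_nonneg hl0 (show 0 ≤ x + y - 1 by linarith))
        (show 0 ≤ 1 - vB by linarith), mul_nonneg hl0 h0, mul_nonneg (sub_nonneg.2 hl1) h0]
  simp only [W2]
  nlinarith [mul_pos (sub_pos.2 hxy) key]

theorem W3_profit_strictMono {vB lam : ℝ} (h0 : 0 ≤ vB) :
    StrictMono (fun h => W3 vB * ((1 + 2*h + lam)/4)) := by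
  intro x y hxy
  simp only [W3]
  nlinarith

theorem W4_profit_strictMonoOn {vB lam : ℝ} (h0 : 0 ≤ vB) (h1 : vB < 1)
    (hl : lam ≤ 1) :
    StrictMonoOn (fun h => W4 vB h * ((1 + 2*h - lam)/4)) (Icc (1/2) 1) := by
  rintro x ⟨hx, _⟩ y ⟨_, _⟩ hxy
  simp only [W4]
  apply mul_lt_mul'' <;> nlinarith

theorem W5_profit_strictMonoOn {vB lam : ℝ} (h0 : 0 ≤ vB) (h1 : vB < 1) (hl : 0 < lam) :
    StrictMonoOn (fun h => W5 vB h * ((h/2) * lam)) (Icc (1/2) 1) := by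
  rintro x ⟨hx, _⟩ y ⟨_, _⟩ hxy
  have hx0 : 0 < x := by linarith
  simp only [W5]
  apply mul_lt_mul''
  · nlinarith
  · gcongr
  · nlinarith
  · positivity

theorem max_W3_W4_W5_profit_strictMonoOn {vB lam : ℝ} (h0 : 0 ≤ vB) (h1 : vB < 1)
    (hl : lam ∈ Icc (0:ℝ) 1) :
    StrictMonoOn (fun h => max (max (W3 vB * ((1 + 2*h + lam)/4))
      (W4 vB h * ((1 + 2*h - lam)/4))) (W5 vB h * ((h/2) * lam))) (Icc (1/2) 1) := by
  intro x hx y hy hxy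
  refine max_lt (max_lt ?_ ?_) ?_
  · exact (W3_profit_strictMono h0 hxy).trans_le ((le_max_left _ _).trans (le_max_left _ _))
  · exact (W4_profit_strictMonoOn h0 h1 hl.2 hx hy hxy).trans_le
      ((le_max_right _ _).trans (le_max_left _ _))
  · rcases hl.1.eq_or_lt with rfl | hl0
    · refine lt_max_of_lt_left (lt_max_of_lt_left ?_)
      have hy0 : 0 < y := by linarith [hy.1]
      simp only [W3, mul_zero]
      positivity
    · exact (W5_profit_strictMonoOn h0 h1 hl0 hx hy hxy).trans_le (le_max_right _ _)

/-- There is a bound `v̄ ∈ (0,1]` such that for every `v_B ∈ [0, v̄]` and `λ ∈ [0,1]`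
there is a threshold `h* ∈ [1/2,1]` with the equilibrium profit strictly decreasing in
precision on `[1/2, h*]` and strictly increasing on `[h*, 1]`. -/
theorem stmt1 :
    ∃ vbar ∈ Ioc (0:ℝ) 1, ∀ vB ∈ Icc (0:ℝ) vbar, ∀ lam ∈ Icc (0:ℝ) 1,
      ∃ hstar ∈ Icc (1/2 : ℝ) 1,
        StrictAntiOn (Mprof vB lam) (Icc (1/2 : ℝ) hstar) ∧
        StrictMonoOn (Mprof vB lam) (Icc hstar 1) := by
  refine ⟨1/8, by norm_num, fun vB hv lam hl => ?_⟩
  have h1 : vB < 1 := by linarith [hv.2]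
  have hanti : StrictAntiOn
      (fun h => max (W1 vB h) (W2 vB h * (1 - ((1 - h)/2) * lam))) (Icc (1/2) 1) :=
    fun x hx y hy hxy => max_lt_max (W1_strictAnti h1 hxy)
      (W2_profit_strictAntiOn hv.1 hv.2 hl hx hy hxy)
  have hM : Mprof vB lam = fun h =>
      max (max (W1 vB h) (W2 vB h * (1 - ((1 - h)/2) * lam)))
        (max (max (W3 vB * ((1 + 2*h + lam)/4)) (W4 vB h * ((1 + 2*h - lam)/4)))
          (W5 vB h * ((h/2) * lam))) := by
    funext h
    simp only [Mprof, max_assoc]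
  rw [hM]
  refine exists_strictAntiOn_strictMonoOn_max (by norm_num) hanti
    (max_W3_W4_W5_profit_strictMonoOn hv.1 h1 hl) ?_ ?_
  · unfold W1 W2
    fun_prop
  · unfold W3 W4 W5
    fun_prop
end

section
/- Let v_B ∈ [0, 5/9). The function G(h) = (1+2h)·(1+2h+(3−2h)·v_B) − 4·(3−2h+(1+2h)·v_B) is strictly increasing on [1/2, 1], satisfies G(1/2) = −2·(2+2·v_B) < 0 and G(1) = 5 − 9·v_B > 0, and therefore has a unique root h_N* in the open interval (1/2, 1). -/
open Set

/-- `G` compares the naive-market high-price profit to the full-coverage profit: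
`G h = 16·(((1+2h)/4)·W4(h) − W2(h))`. -/
noncomputable def G (vB h : ℝ) : ℝ :=
  (1 + 2*h) * (1 + 2*h + (3 - 2*h) * vB) - 4 * (3 - 2*h + (1 + 2*h) * vB)

theorem G_sub_G (vB a b : ℝ) :
    G vB b - G vB a = 4 * (b - a) * (2 + (1 + a + b) * (1 - vB)) := by
  unfold G
  ring

theorem G_strictMonoOn {vB : ℝ} (hv : vB ≤ 1) : StrictMonoOn (G vB) (Icc (1/2:ℝ) 1) := by
  intro a ha b hb hab
  have h₁ : 0 ≤ (1 + a + b) * (1 - vB) :=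
    mul_nonneg (by linarith [ha.1, hb.1]) (by linarith)
  have h₂ : 0 < 4 * (b - a) * (2 + (1 + a + b) * (1 - vB)) :=
    mul_pos (by linarith) (by linarith)
  linarith [G_sub_G vB a b]

theorem continuous_G (vB : ℝ) : Continuous (G vB) := by
  unfold G
  fun_prop

/-- For `v_B ∈ [0, 5/9)`, `G` is strictly increasing on `[1/2, 1]`, negative at `1/2`,
positive at `1`, and has a unique root in `(1/2, 1)`. -/
theorem stmt3 (vB : ℝ) (hv : vB ∈ Ico (0:ℝ) (5/9)) :
    StrictMonoOn (G vB) (Icc (1/2:ℝ) 1) ∧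
    G vB (1/2) = -2 * (2 + 2*vB) ∧ G vB (1/2) < 0 ∧
    G vB 1 = 5 - 9*vB ∧ 0 < G vB 1 ∧
    ∃! h : ℝ, h ∈ Ioo (1/2:ℝ) 1 ∧ G vB h = 0 := by
  obtain ⟨hv₀, hv₁⟩ := hv
  have hmono : StrictMonoOn (G vB) (Icc (1/2:ℝ) 1) := G_strictMonoOn (by linarith)
  have hhalf : G vB (1/2) = -2 * (2 + 2*vB) := by unfold G; ring
  have hone : G vB 1 = 5 - 9*vB := by unfold G; ring
  have hneg : G vB (1/2) < 0 := by linarith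
  have hpos : 0 < G vB 1 := by linarith
  refine ⟨hmono, hhalf, hneg, hone, hpos, ?_⟩
  obtain ⟨h, hh, hroot⟩ :=
    intermediate_value_Ioo (by norm_num) (continuous_G vB).continuousOn ⟨hneg, hpos⟩
  refine ⟨h, ⟨hh, hroot⟩, fun k ⟨hk, hkroot⟩ => ?_⟩
  exact hmono.injOn (Ioo_subset_Icc_self hk) (Ioo_subset_Icc_self hh) (hkroot.trans hroot.symm)
end

section
/- Let h ∈ [1/2,1] and v_B ∈ [0,1), and define the naive-market high-quality profit function Π(p) = p for 0 ≤ p ≤ W2(h), Π(p) = ((1+2h)/4)·p for W2(h) < p ≤ W4(h), and Π(p) = 0 for p > W4(h). If G(h) < 0 then p = W2(h) is the unique maximizer of Π over [0,∞), with maximal value W2(h); if G(h) > 0 then p = W4(h) is the unique maximizer, with maximal value ((1+2h)/4)·W4(h). -/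
open Set

/-- The naive-market high-quality pooling profit as a function of price. -/
noncomputable def ProfitN (vB h p : ℝ) : ℝ :=
  if p ≤ W2 vB h then p
  else if p ≤ W4 vB h then ((1 + 2*h)/4) * p
  else 0

theorem G_eq (vB h : ℝ) : G vB h = 16 * (((1 + 2*h)/4) * W4 vB h - W2 vB h) := by
  unfold G W4 W2
  ring

theorem W2_pos {vB h : ℝ} (hh : h ∈ Icc (1/2:ℝ) 1) (hv : 0 ≤ vB) : 0 < W2 vB h := by
  have h1 : 0 ≤ (1 + 2*h)/4 * vB := mul_nonneg (by linarith [hh.1]) hv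
  unfold W2
  linarith [hh.2]

/-- If `G(h) < 0` then `W2(h)` is the unique maximizer of the naive-market
high-quality profit over `[0, ∞)`, with maximal value `W2(h)`; if `G(h) > 0`
then `W4(h)` is the unique maximizer, with maximal value `((1+2h)/4)·W4(h)`. -/
theorem stmt4 (h vB : ℝ) (hh : h ∈ Icc (1/2:ℝ) 1) (hv : vB ∈ Ico (0:ℝ) 1) :
    (G vB h < 0 →
      ProfitN vB h (W2 vB h) = W2 vB h ∧
      ∀ p ∈ Ici (0:ℝ), p ≠ W2 vB h → ProfitN vB h p < W2 vB h) ∧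
    (0 < G vB h →
      ProfitN vB h (W4 vB h) = ((1 + 2*h)/4) * W4 vB h ∧
      ∀ p ∈ Ici (0:ℝ), p ≠ W4 vB h → ProfitN vB h p < ((1 + 2*h)/4) * W4 vB h) := by
  have hG := G_eq vB h
  have hW2 := W2_pos hh hv.1
  have hc : 0 < (1 + 2*h)/4 := by linarith [hh.1]
  have hc1 : (1 + 2*h)/4 < 1 := by linarith [hh.2]
  refine ⟨fun hneg => ⟨if_pos le_rfl, fun p _ hp => ?_⟩, fun hpos => ?_⟩
  · unfold ProfitN
    split_ifs with h2 h4
    · exact lt_of_le_of_ne h2 hp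
    · have := mul_le_mul_of_nonneg_left h4 hc.le
      linarith
    · exact hW2
  · have hlt : W2 vB h < (1 + 2*h)/4 * W4 vB h := by linarith
    have hW4 : 0 < W4 vB h := pos_of_mul_pos_right (hW2.trans hlt) hc.le
    have h24 : W2 vB h < W4 vB h := hlt.trans (mul_lt_of_lt_one_left hW4 hc1)
    refine ⟨by rw [ProfitN, if_neg h24.not_ge, if_pos le_rfl], fun p _ hp => ?_⟩
    unfold ProfitN
    split_ifs with h2 h4
    · exact h2.trans_lt hlt
    · exact mul_lt_mul_of_pos_left (lt_of_le_of_ne h4 hp) hc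
    · exact mul_pos hc hW4
end

section
/- Let v_B ∈ [0, 5/9) and let h_N* ∈ (1/2,1) be the unique root of G. The naive-market high-quality equilibrium profit Π̃_H(h) = max(W2(h), ((1+2h)/4)·W4(h)) is strictly decreasing in h on [1/2, h_N*] and strictly increasing in h on [h_N*, 1]. (In particular, h ↦ W2(h) is strictly decreasing and h ↦ ((1+2h)/4)·W4(h) is strictly increasing on [1/2,1].) -/
open Set

theorem StrictAntiOn.max_left_of_eq {α β : Type*} [LinearOrder α] [LinearOrder β]
    {f g : α → β} {a b c : α} (hf : StrictAntiOn f (Icc a b)) (hg : StrictMonoOn g (Icc a b))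
    (hc : c ∈ Icc a b) (hfg : f c = g c) :
    StrictAntiOn (fun x => max (f x) (g x)) (Icc a c) := by
  intro x hx y hy hxy
  have hx' : x ∈ Icc a b := ⟨hx.1, hx.2.trans hc.2⟩
  have hy' : y ∈ Icc a b := ⟨hy.1, hy.2.trans hc.2⟩
  have hgf : g y ≤ f y :=
    (hg.monotoneOn hy' hc hy.2).trans (hfg.ge.trans (hf.antitoneOn hy' hc hy.2))
  exact (max_eq_left hgf).trans_lt ((hf hx' hy' hxy).trans_le (le_max_left _ _))

theorem StrictMonoOn.max_right_of_eq {α β : Type*} [LinearOrder α] [LinearOrder β]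
    {f g : α → β} {a b c : α} (hf : StrictAntiOn f (Icc a b)) (hg : StrictMonoOn g (Icc a b))
    (hc : c ∈ Icc a b) (hfg : f c = g c) :
    StrictMonoOn (fun x => max (f x) (g x)) (Icc c b) := by
  intro x hx y hy hxy
  have hx' : x ∈ Icc a b := ⟨hc.1.trans hx.1, hx.2⟩
  have hy' : y ∈ Icc a b := ⟨hc.1.trans hy.1, hy.2⟩
  have hfx : f x ≤ g x :=
    (hf.antitoneOn hc hx' hx.1).trans (hfg.le.trans (hg.monotoneOn hc hx' hx.1))
  exact (max_eq_right hfx).trans_lt ((hg hx' hy' hxy).trans_le (le_max_right _ _))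

theorem strictAnti_W2 {vB : ℝ} (hv : vB < 1) : StrictAnti (W2 vB) := by
  intro x y hxy
  unfold W2
  nlinarith [mul_pos (sub_pos.2 hxy) (sub_pos.2 hv)]

theorem strictMonoOn_mul_W4 {vB : ℝ} (h0 : 0 ≤ vB) (h1 : vB < 1) :
    StrictMonoOn (fun h => ((1 + 2*h)/4) * W4 vB h) (Icc (1/2:ℝ) 1) := by
  intro x hx y hy hxy
  have hd : 0 < (y - x) * ((1 - vB) * (1 + x + y) + 2 * vB) :=
    mul_pos (sub_pos.2 hxy) (add_pos_of_pos_of_nonneg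
      (mul_pos (sub_pos.2 h1) (by linarith [hx.1, hy.1])) (by linarith))
  simp only [W4]
  linarith

/-- For `v_B ∈ [0, 5/9)` and `h_N*` the unique root of `G` in `(1/2,1)`, the
naive-market high-quality equilibrium profit `max(W2(h), ((1+2h)/4)·W4(h))` is
strictly decreasing on `[1/2, h_N*]` and strictly increasing on `[h_N*, 1]`; in
particular `W2` is strictly decreasing and `((1+2h)/4)·W4(h)` strictly increasing. -/
theorem stmt5 (vB hN : ℝ) (hv : vB ∈ Ico (0:ℝ) (5/9))
    (hN1 : hN ∈ Ioo (1/2:ℝ) 1) (hroot : G vB hN = 0)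
    (huniq : ∀ h ∈ Ioo (1/2:ℝ) 1, G vB h = 0 → h = hN) :
    StrictAntiOn (fun h => max (W2 vB h) (((1 + 2*h)/4) * W4 vB h)) (Icc (1/2:ℝ) hN) ∧
    StrictMonoOn (fun h => max (W2 vB h) (((1 + 2*h)/4) * W4 vB h)) (Icc hN 1) ∧
    StrictAntiOn (fun h => W2 vB h) (Icc (1/2:ℝ) 1) ∧
    StrictMonoOn (fun h => ((1 + 2*h)/4) * W4 vB h) (Icc (1/2:ℝ) 1) := by
  have hv1 : vB < 1 := by linarith [hv.2]
  have hf : StrictAntiOn (fun h => W2 vB h) (Icc (1/2:ℝ) 1) := (strictAnti_W2 hv1).strictAntiOn _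
  have hg := strictMonoOn_mul_W4 hv.1 hv1
  have hc : hN ∈ Icc (1/2:ℝ) 1 := Ioo_subset_Icc_self hN1
  have hfg : W2 vB hN = ((1 + 2*hN)/4) * W4 vB hN := by
    rw [G_eq] at hroot
    linarith
  exact ⟨hf.max_left_of_eq hg hc hfg, StrictMonoOn.max_right_of_eq hf hg hc hfg, hf, hg⟩
end

section
/- Let v_B ∈ [0, 5/9) and let h_N* ∈ (1/2,1) be the unique root of G. The naive-market low-quality equilibrium profit Π̃_L(h), defined as W2(h) for h ≤ h_N* and as ((3−2h)/4)·W4(h) for h > h_N*, is strictly decreasing in h on [1/2, 1]. -/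
open Set

/-- The low-quality profit at the high price is strictly decreasing in the precision. -/
theorem strictAntiOn_mul_W4 {vB : ℝ} (hv0 : 0 ≤ vB) (hv1 : vB < 1) :
    StrictAntiOn (fun h => ((3 - 2*h)/4) * W4 vB h) (Ici (1/2:ℝ)) := by
  intro x hx y _ hxy
  have hx' : 1/2 ≤ x := hx
  have key : 0 < 4 - ((3 - 2*x) + (3 - 2*y)) * (1 - vB) := by
    rcases le_total 0 ((3 - 2*x) + (3 - 2*y)) with h | h <;> nlinarith
  simp only [W4]
  nlinarith [mul_pos (sub_pos.2 hxy) key]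

/-- At a root of `G` the low price yields the low-quality firm strictly more. -/
theorem mul_W4_lt_W2_of_G_eq_zero {vB h : ℝ} (hv : 0 ≤ vB) (hh : h ∈ Ioo (1/2:ℝ) 1)
    (hG : G vB h = 0) : ((3 - 2*h)/4) * W4 vB h < W2 vB h := by
  obtain ⟨h1, h2⟩ := hh
  have hW4 : 0 < W4 vB h := by
    have : 0 ≤ (3 - 2*h)/4 * vB := mul_nonneg (by linarith) hv
    unfold W4
    linarith
  have hW2 : W2 vB h = ((1 + 2*h)/4) * W4 vB h := by
    unfold G at hG
    unfold W2 W4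
    linarith
  rw [hW2]
  exact mul_lt_mul_of_pos_right (by linarith) hW4

/-- For `v_B ∈ [0, 5/9)` and `h_N*` the unique root of `G` in `(1/2,1)`, the
naive-market low-quality equilibrium profit — `W2(h)` for `h ≤ h_N*` and
`((3−2h)/4)·W4(h)` for `h > h_N*` — is strictly decreasing on `[1/2, 1]`. -/
theorem stmt6 (vB hN : ℝ) (hv : vB ∈ Ico (0:ℝ) (5/9))
    (hN1 : hN ∈ Ioo (1/2:ℝ) 1) (hroot : G vB hN = 0)
    (huniq : ∀ h ∈ Ioo (1/2:ℝ) 1, G vB h = 0 → h = hN) :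
    StrictAntiOn (fun h => if h ≤ hN then W2 vB h else ((3 - 2*h)/4) * W4 vB h)
      (Icc (1/2:ℝ) 1) := by
  obtain ⟨hv0, hv1⟩ := hv
  have hv1' : vB < 1 := by linarith
  have hW2 := strictAnti_W2 hv1'
  have hW4 := strictAntiOn_mul_W4 hv0 hv1'
  intro x hx y hy hxy
  dsimp only
  split_ifs with hyN hxN hxN
  · exact hW2 hxy
  · exact absurd (hxy.le.trans hyN) hxN
  · exact (hW4 hN1.1.le hy.1 (not_le.1 hyN)).trans
      ((mul_W4_lt_W2_of_G_eq_zero hv0 hN1 hroot).trans_le (hW2.antitone hxN))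
  · exact hW4 hx.1 hy.1 hxy
end

section
/- Let v_B ∈ [0,1). The equation 4·(1 − h·(1−v_B)) = (1+h)·(1+v_B) has a unique solution h_S* in the open interval (1/2,1). Moreover, (h/2)·W5(h) ≤ ((1+h)/2)·W3 for all h ∈ [1/2,1], and the sophisticated-market high-quality equilibrium profit Π̃_H(h) = max(W1(h), ((1+h)/2)·W3, (h/2)·W5(h)) = max(W1(h), ((1+h)/2)·W3) is strictly decreasing in h on [1/2, h_S*] and strictly increasing in h on [h_S*, 1]. -/
open Set

/-- At the threshold `hS` the two profits agree, and their difference is affine in `h`. -/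
lemma W1_sub_eq {vB hS : ℝ} (hS_eq : 4 * (1 - hS * (1 - vB)) = (1 + hS) * (1 + vB)) (h : ℝ) :
    W1 vB h - ((1 + h)/2) * W3 vB = (5 - 3 * vB) / 4 * (hS - h) := by
  unfold W1 W3
  linear_combination hS_eq / 4

lemma W5_profit_le {vB h : ℝ} (hv : 0 ≤ vB) (hh : h ∈ Icc (1/2:ℝ) 1) :
    (h/2) * W5 vB h ≤ ((1 + h)/2) * W3 vB := by
  obtain ⟨h_ge, h_le⟩ := hh
  have key : 0 ≤ (1 - h) * (1 + 2 * h) + vB * ((1 - h) + 2 * h ^ 2) := by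
    have : 0 ≤ 1 - h := by linarith
    positivity
  unfold W3 W5
  linarith

/-- The equation `4·(1 − h·(1−v_B)) = (1+h)·(1+v_B)` has a unique solution `h_S*`
in `(1/2, 1)`; moreover `(h/2)·W5(h) ≤ ((1+h)/2)·W3` on `[1/2,1]`, so the
sophisticated-market high-quality equilibrium profit
`max(W1(h), ((1+h)/2)·W3, (h/2)·W5(h)) = max(W1(h), ((1+h)/2)·W3)` is strictly
decreasing on `[1/2, h_S*]` and strictly increasing on `[h_S*, 1]`. -/
theorem stmt7 (vB : ℝ) (hv : vB ∈ Ico (0:ℝ) 1) :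
    (∃! hS : ℝ, hS ∈ Ioo (1/2:ℝ) 1 ∧ 4 * (1 - hS * (1 - vB)) = (1 + hS) * (1 + vB)) ∧
    (∀ h ∈ Icc (1/2:ℝ) 1, (h/2) * W5 vB h ≤ ((1 + h)/2) * W3 vB) ∧
    (∀ h ∈ Icc (1/2:ℝ) 1,
      max (W1 vB h) (max (((1 + h)/2) * W3 vB) ((h/2) * W5 vB h)) =
        max (W1 vB h) (((1 + h)/2) * W3 vB)) ∧
    ∀ hS ∈ Ioo (1/2:ℝ) 1, 4 * (1 - hS * (1 - vB)) = (1 + hS) * (1 + vB) →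
      StrictAntiOn (fun h => max (W1 vB h) (((1 + h)/2) * W3 vB)) (Icc (1/2:ℝ) hS) ∧
      StrictMonoOn (fun h => max (W1 vB h) (((1 + h)/2) * W3 vB)) (Icc hS 1) := by
  have hW5 : ∀ h ∈ Icc (1/2:ℝ) 1, (h/2) * W5 vB h ≤ ((1 + h)/2) * W3 vB :=
    fun h hh => W5_profit_le hv.1 hh
  obtain ⟨hv0, hv1⟩ := hv
  have hpos : 0 < 5 - 3 * vB := by linarith
  refine ⟨⟨(3 - vB) / (5 - 3 * vB), ⟨⟨?_, ?_⟩, ?_⟩, ?_⟩, hW5, ?_, ?_⟩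
  · rw [lt_div_iff₀ hpos]; linarith
  · rw [div_lt_one hpos]; linarith
  · field_simp
    ring
  · rintro h ⟨-, h_eq⟩
    rw [eq_div_iff hpos.ne']
    linarith
  · intro h hh
    rw [max_eq_left (hW5 h hh)]
  · intro hS _ hS_eq
    constructor
    · have hanti : StrictAntiOn (W1 vB) (Icc (1/2:ℝ) hS) := by
        intro a _ b _ hab
        unfold W1
        nlinarith
      refine hanti.congr fun h hh => (max_eq_left ?_).symm
      rw [← sub_nonneg, W1_sub_eq hS_eq]
      exact mul_nonneg (by linarith) (sub_nonneg.2 hh.2)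
    · have hmono : StrictMonoOn (fun h => ((1 + h)/2) * W3 vB) (Icc hS 1) := by
        intro a _ b _ hab
        unfold W3
        dsimp only
        gcongr
      refine hmono.congr fun h hh => (max_eq_right ?_).symm
      rw [← sub_nonpos, W1_sub_eq hS_eq]
      exact mul_nonpos_of_nonneg_of_nonpos (by linarith) (sub_nonpos.2 hh.1)
end

section
/- Let v_B ∈ [0,1) and let h_S* ∈ (1/2,1) be the unique solution of 4·(1 − h·(1−v_B)) = (1+h)·(1+v_B). The sophisticated-market low-quality equilibrium profit Π̃_L(h), defined as W1(h) for h ≤ h_S* and as ((2−h)/2)·W3 for h > h_S*, is strictly decreasing in h on [1/2, 1]. -/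
open Set

/-- For `h_S*` the unique solution of `4·(1 − h·(1−v_B)) = (1+h)·(1+v_B)` in `(1/2,1)`,
the sophisticated-market low-quality equilibrium profit — `W1(h)` for `h ≤ h_S*` and
`((2−h)/2)·W3` for `h > h_S*` — is strictly decreasing on `[1/2, 1]`. -/
theorem stmt8 (vB hS : ℝ) (hv : vB ∈ Ico (0:ℝ) 1)
    (hS1 : hS ∈ Ioo (1/2:ℝ) 1)
    (hroot : 4 * (1 - hS * (1 - vB)) = (1 + hS) * (1 + vB))
    (huniq : ∀ h ∈ Ioo (1/2:ℝ) 1, 4 * (1 - h * (1 - vB)) = (1 + h) * (1 + vB) → h = hS) :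
    StrictAntiOn (fun h => if h ≤ hS then W1 vB h else ((2 - h)/2) * W3 vB)
      (Icc (1/2:ℝ) 1) := by
  obtain ⟨hv0, hv1⟩ := hv
  intro a _ b _ hab
  simp only [W1, W3]
  split_ifs with hb ha ha
  · nlinarith [mul_pos (sub_pos.2 hab) (sub_pos.2 hv1)]
  · exact absurd (hab.le.trans hb) ha
  · -- At `hS` the profit jumps down, since `2 - b < 1 + hS`.
    have hjump : 0 < (b + hS - 1) * (1 + vB) :=
      mul_pos (by linarith [hS1.1]) (by linarith)
    nlinarith [mul_nonneg (sub_nonneg.2 ha) (sub_pos.2 hv1).le]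
  · nlinarith
end

section
/- Let v_B ∈ [0, 5/9). If h_S ∈ (1/2,1) satisfies 4·(1 − h_S·(1−v_B)) = (1+h_S)·(1+v_B) and h_N ∈ (1/2,1) satisfies (1+2h_N)·(1+2h_N+(3−2h_N)·v_B) = 4·(3−2h_N+(1+2h_N)·v_B), then h_S < h_N. That is, the precision threshold above which the firm abandons full market coverage is lower in a sophisticated market than in a naive market. -/
open Set

/-- For `v_B ∈ [0, 5/9)`, the sophisticated-market precision threshold `h_S` (solving
`4·(1 − h(1−v_B)) = (1+h)(1+v_B)`) is smaller than the naive-market threshold `h_N`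
(solving `(1+2h)(1+2h+(3−2h)v_B) = 4(3−2h+(1+2h)v_B)`). -/
theorem stmt9 (vB hS hN : ℝ) (hv : vB ∈ Ico (0:ℝ) (5/9))
    (hS1 : hS ∈ Ioo (1/2:ℝ) 1)
    (hSr : 4 * (1 - hS * (1 - vB)) = (1 + hS) * (1 + vB))
    (hN1 : hN ∈ Ioo (1/2:ℝ) 1)
    (hNr : (1 + 2*hN) * (1 + 2*hN + (3 - 2*hN) * vB) = 4 * (3 - 2*hN + (1 + 2*hN) * vB)) :
    hS < hN := by
  obtain ⟨hv0, hv1⟩ := hv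
  have hS_lt : hS < 11 / 15 := by
    by_contra! h
    nlinarith [mul_nonneg (sub_nonneg.2 h) (by linarith : 0 ≤ 5 - 3 * vB)]
  have hN_gt : 11 / 15 < hN := by
    have hN0 := hN1.1
    have hquad : 16 ≤ (1 + 2 * hN) ^ 2 + 4 * (1 + 2 * hN) := by
      nlinarith [mul_nonneg hv0 (sq_nonneg (1 + 2 * hN))]
    by_contra! h
    nlinarith
  exact hS_lt.trans hN_gt
end

section
/- Let v_B ∈ [0, 1/5). The function F(h) = (1+2h)·(1+2h+(3−2h)·v_B) − 4·(1+h)·(1+v_B) is strictly increasing on [1/2,1] (its derivative is 8h·(1−v_B) > 0), satisfies F(1/2) = −2·(1+v_B) < 0 and F(1) = 1 − 5·v_B > 0, and therefore has a unique root h̄ ∈ (1/2,1); moreover ((1+2h)/4)·W4(h) > ((1+h)/2)·W3 if and only if h > h̄. That is, when precision exceeds h̄, the high-quality firm's naive-market high-price profit strictly exceeds its sophisticated-market mid-price profit. -/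
open Set

/-- `F h = 16·(((1+2h)/4)·W4(h) − ((1+h)/2)·W3)` compares the naive-market high-price
profit with the sophisticated-market mid-price profit. -/
noncomputable def F (vB h : ℝ) : ℝ :=
  (1 + 2*h) * (1 + 2*h + (3 - 2*h) * vB) - 4 * (1 + h) * (1 + vB)

theorem F_eq (vB h : ℝ) : F vB h = 4 * (1 - vB) * h ^ 2 - (3 + vB) := by
  unfold F
  ring

theorem strictMonoOn_F {vB : ℝ} (hv : vB < 1) : StrictMonoOn (F vB) (Ici 0) := by
  intro a ha b _ hab
  have hsq : a ^ 2 < b ^ 2 := pow_lt_pow_left₀ hab ha two_ne_zero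
  have hc : 0 < 4 * (1 - vB) := by linarith
  rw [F_eq, F_eq]
  exact sub_lt_sub_right (mul_lt_mul_of_pos_left hsq hc) _

theorem hasDerivAt_F (vB h : ℝ) : HasDerivAt (F vB) (8 * h * (1 - vB)) h := by
  rw [show F vB = fun x => 4 * (1 - vB) * x ^ 2 - (3 + vB) from funext (F_eq vB)]
  refine (((hasDerivAt_pow 2 h).const_mul (4 * (1 - vB))).sub_const (3 + vB)).congr_deriv ?_
  push_cast
  ring

theorem F_eq_profit_sub (vB h : ℝ) :
    F vB h = 16 * (((1 + 2*h)/4) * W4 vB h - ((1 + h)/2) * W3 vB) := by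
  unfold F W4 W3
  ring

/-- For `v_B ∈ [0, 1/5)`, `F` is strictly increasing on `[1/2,1]` (its derivative is
`8h(1−v_B) > 0`), with `F(1/2) = −2(1+v_B) < 0` and `F(1) = 1 − 5v_B > 0`, so it has a
unique root `h̄ ∈ (1/2,1)`; moreover `((1+2h)/4)·W4(h) > ((1+h)/2)·W3` iff `h > h̄`. -/
theorem stmt11 (vB : ℝ) (hv : vB ∈ Ico (0:ℝ) (1/5)) :
    StrictMonoOn (F vB) (Icc (1/2:ℝ) 1) ∧
    (∀ h : ℝ, HasDerivAt (F vB) (8 * h * (1 - vB)) h) ∧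
    (∀ h ∈ Icc (1/2:ℝ) 1, 0 < 8 * h * (1 - vB)) ∧
    F vB (1/2) = -2 * (1 + vB) ∧ F vB (1/2) < 0 ∧
    F vB 1 = 1 - 5 * vB ∧ 0 < F vB 1 ∧
    (∃! hbar : ℝ, hbar ∈ Ioo (1/2:ℝ) 1 ∧ F vB hbar = 0) ∧
    ∀ hbar ∈ Ioo (1/2:ℝ) 1, F vB hbar = 0 →
      ∀ h ∈ Icc (1/2:ℝ) 1,
        (((1 + 2*h)/4) * W4 vB h > ((1 + h)/2) * W3 vB ↔ h > hbar) := by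
  obtain ⟨h0, h5⟩ := hv
  have hmono : StrictMonoOn (F vB) (Icc (1/2:ℝ) 1) :=
    (strictMonoOn_F (by linarith)).mono fun x hx => by
      have := hx.1
      simp only [mem_Ici]
      linarith
  have hhalf : F vB (1/2) = -2 * (1 + vB) := by rw [F_eq]; ring
  have hone : F vB 1 = 1 - 5 * vB := by rw [F_eq]; ring
  have hneg : F vB (1/2) < 0 := by rw [hhalf]; linarith
  have hpos : 0 < F vB 1 := by rw [hone]; linarith
  refine ⟨hmono, hasDerivAt_F vB, ?_, hhalf, hneg, hone, hpos, ?_, ?_⟩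
  · intro h hh
    have : 0 < h := by linarith [hh.1]
    have : 0 < 1 - vB := by linarith
    positivity
  · have hcont : ContinuousOn (F vB) (Icc (1/2:ℝ) 1) :=
      fun x _ => (hasDerivAt_F vB x).continuousAt.continuousWithinAt
    obtain ⟨r, hr, hr0⟩ := intermediate_value_Ioo (by norm_num) hcont ⟨hneg, hpos⟩
    exact ⟨r, ⟨hr, hr0⟩, fun y hy =>
      hmono.injOn (Ioo_subset_Icc_self hy.1) (Ioo_subset_Icc_self hr) (hy.2.trans hr0.symm)⟩
  · intro r hr hr0 h hh
    rw [gt_iff_lt, gt_iff_lt, ← hmono.lt_iff_lt (Ioo_subset_Icc_self hr) hh, hr0, F_eq_profit_sub]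
    constructor <;> intro <;> linarith
end

section
/- Let h ∈ (1/2,1], v_B ∈ (0,1), and μ = (1+2h)/4. If v_B < (3−2h)/4, then α* = 1/v_B − 4/(3−2h) is the unique positive real number α satisfying the indifference equation ((3−2h)/4)·( (μ/(μ+(1−μ)·α))·(1−v_B) + v_B ) = v_B. Moreover, α* ∈ (0,1) if and only if v_B ∈ ((3−2h)/(7−2h), (3−2h)/4). -/
open Set

/-- With `q = 1 - μ`, the indifference equation `q (μ / (μ + q α) (1 - v) + v) = v` has the
closed-form solution `α = 1 / v - 1 / q`. -/
lemma indifference_iff {q v α : ℝ} (hq : 0 < q) (hq1 : q < 1) (hv : 0 < v) (hα : 0 < α) :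
    q * ((1 - q) / (1 - q + q * α) * (1 - v) + v) = v ↔ α = 1 / v - 1 / q := by
  have hμ : 0 < 1 - q := sub_pos.2 hq1
  have hD : 0 < 1 - q + q * α := by positivity
  have hsub : q * ((1 - q) / (1 - q + q * α) * (1 - v) + v) - v =
      (1 - q) / (1 - q + q * α) * (q - v - v * q * α) := by
    field_simp
    ring
  have hα' : α - (1 / v - 1 / q) = -(q - v - v * q * α) / (v * q) := by
    field_simp
    ring
  rw [← sub_eq_zero, hsub, ← sub_eq_zero (a := α), hα', div_eq_zero_iff, neg_eq_zero,
    mul_eq_zero]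
  simp [hμ.ne', hD.ne', hv.ne', hq.ne']

/-- In the mixed-strategy extension with naive consumers, if `v_B < (3−2h)/4` then
`α* = 1/v_B − 4/(3−2h)` is the unique positive solution of the low-quality firm's
indifference equation `((3−2h)/4)·((μ/(μ+(1−μ)α))·(1−v_B) + v_B) = v_B`, where
`μ = (1+2h)/4`; moreover `α* ∈ (0,1)` iff `v_B ∈ ((3−2h)/(7−2h), (3−2h)/4)`. -/
theorem stmt13 (h vB : ℝ) (hh : h ∈ Ioc (1/2:ℝ) 1) (hv : vB ∈ Ioo (0:ℝ) 1) :
    (vB < (3 - 2*h)/4 →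
      0 < 1/vB - 4/(3 - 2*h) ∧
      ((3 - 2*h)/4) *
          ((((1 + 2*h)/4) / ((1 + 2*h)/4 + (1 - (1 + 2*h)/4) * (1/vB - 4/(3 - 2*h)))) *
            (1 - vB) + vB) = vB ∧
      (∀ α : ℝ, 0 < α →
        ((3 - 2*h)/4) *
            ((((1 + 2*h)/4) / ((1 + 2*h)/4 + (1 - (1 + 2*h)/4) * α)) * (1 - vB) + vB) = vB →
        α = 1/vB - 4/(3 - 2*h))) ∧
    ((1/vB - 4/(3 - 2*h)) ∈ Ioo (0:ℝ) 1 ↔ vB ∈ Ioo ((3 - 2*h)/(7 - 2*h)) ((3 - 2*h)/4)) := by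
  obtain ⟨hh1, hh2⟩ := hh
  obtain ⟨hv0, -⟩ := hv
  have h3 : 0 < 3 - 2 * h := by linarith
  have h7 : 0 < 7 - 2 * h := by linarith
  have hpos : 0 < 1 / vB - 4 / (3 - 2 * h) ↔ vB < (3 - 2 * h) / 4 := by
    rw [sub_pos, div_lt_div_iff₀ h3 hv0, lt_div_iff₀ four_pos, one_mul, mul_comm]
  have hlt : 1 / vB - 4 / (3 - 2 * h) < 1 ↔ (3 - 2 * h) / (7 - 2 * h) < vB := by
    have hsum : 1 + 4 / (3 - 2 * h) = (7 - 2 * h) / (3 - 2 * h) := by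
      field_simp
      ring
    rw [sub_lt_iff_lt_add, hsum, div_lt_div_iff₀ hv0 h3, div_lt_iff₀ h7, one_mul, mul_comm vB]
  have key : ∀ α : ℝ, 0 < α →
      (((3 - 2*h)/4) *
        ((((1 + 2*h)/4) / ((1 + 2*h)/4 + (1 - (1 + 2*h)/4) * α)) * (1 - vB) + vB) = vB ↔
        α = 1/vB - 4/(3 - 2*h)) := by
    intro α hα
    have hμ : (1 + 2 * h) / 4 = 1 - (3 - 2 * h) / 4 := by ring
    rw [hμ, sub_sub_cancel,
      indifference_iff (by linarith) (by linarith) hv0 hα, one_div_div]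
  refine ⟨fun hlt' => ?_, ?_⟩
  · have hα := hpos.2 hlt'
    exact ⟨hα, (key _ hα).2 rfl, fun α hα => (key α hα).1⟩
  · rw [mem_Ioo, mem_Ioo, hpos, hlt, and_comm]
end

section
/- Let v_B ∈ (0,1) and for h ∈ (1/2,1) define the mixed-strategy equilibrium high price p̄(h) = 4·v_B/(3−2h). Then the high-quality firm's equilibrium profit ((1+2h)/4)·p̄(h) = (1+2h)·v_B/(3−2h) is strictly increasing in h on (1/2,1), while the low-quality firm's equilibrium profit α·((3−2h)/4)·p̄(h) + (1−α)·v_B equals v_B for every α ∈ [0,1] and is therefore independent of h. -/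
open Set

/-- In the mixed-strategy equilibrium with high price `p̄(h) = 4v_B/(3−2h)`, the
high-quality firm's profit `((1+2h)/4)·p̄(h) = (1+2h)·v_B/(3−2h)` is strictly
increasing in `h` on `(1/2,1)`, while the low-quality firm's profit
`α·((3−2h)/4)·p̄(h) + (1−α)·v_B` equals `v_B` for every `α ∈ [0,1]`. -/
theorem stmt14 (vB : ℝ) (hv : vB ∈ Ioo (0:ℝ) 1) :
    StrictMonoOn (fun h => ((1 + 2*h)/4) * (4 * vB / (3 - 2*h))) (Ioo (1/2:ℝ) 1) ∧
    (∀ h ∈ Ioo (1/2:ℝ) 1,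
      ((1 + 2*h)/4) * (4 * vB / (3 - 2*h)) = (1 + 2*h) * vB / (3 - 2*h)) ∧
    (∀ h ∈ Ioo (1/2:ℝ) 1, ∀ α ∈ Icc (0:ℝ) 1,
      α * (((3 - 2*h)/4) * (4 * vB / (3 - 2*h))) + (1 - α) * vB = vB) := by
  refine ⟨?_, fun h _ => by ring, ?_⟩
  · rintro a ⟨_, ha⟩ b ⟨_, hb⟩ hab
    have ha' : 0 < 3 - 2 * a := by linarith
    have hb' : 0 < 3 - 2 * b := by linarith
    have hprofit (h : ℝ) :
        ((1 + 2*h)/4) * (4 * vB / (3 - 2*h)) = (1 + 2*h) * vB / (3 - 2*h) := by ring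
    simp only [hprofit]
    rw [div_lt_div_iff₀ ha' hb']
    nlinarith [mul_pos hv.1 (sub_pos.2 hab)]
  · rintro h ⟨_, hh⟩ α _
    have h' : 3 - 2 * h ≠ 0 := by linarith
    field_simp
    ring
end

section
/- Let h ∈ (1/2,1] and define w̄(γ) = (1 + γ·(2h−1))/2 for γ ∈ (0,1). The low-quality firm's equilibrium profit L(γ), defined as 1 − w̄(γ) when 1 − w̄(γ) ≥ w̄(γ)² and as (1 − w̄(γ))·w̄(γ) otherwise, is strictly decreasing in γ on (0,1). -/
open Set

/-- Average precision when a high-precision signal (of precision `h`) occurs with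
probability `γ` and a low-precision (`1/2`) signal otherwise. -/
noncomputable def wbar (h γ : ℝ) : ℝ := (1 + γ * (2*h - 1))/2

theorem wbar_strictMono {h : ℝ} (hh : 1 / 2 < h) : StrictMono (wbar h) := by
  intro a b hab
  unfold wbar
  nlinarith [mul_pos (sub_pos.2 hab) (sub_pos.2 hh)]

theorem wbar_mem_Ioo {h γ : ℝ} (hh : h ∈ Ioc (1 / 2 : ℝ) 1) (hγ : γ ∈ Ioo (0 : ℝ) 1) :
    wbar h γ ∈ Ioo (1 / 2 : ℝ) 1 := by
  obtain ⟨h1, h2⟩ := hh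
  obtain ⟨g0, g1⟩ := hγ
  unfold wbar
  constructor <;> nlinarith [mul_pos g0 (sub_pos.2 h1), mul_pos (sub_pos.2 g1) (sub_pos.2 h1)]

/-- The low-quality firm's equilibrium profit — `1 − w̄(γ)` when `1 − w̄(γ) ≥ w̄(γ)²`
(low equilibrium price) and `(1 − w̄(γ))·w̄(γ)` otherwise (high equilibrium price) —
is strictly decreasing in `γ` on `(0,1)`. -/
theorem stmt15 (h : ℝ) (hh : h ∈ Ioc (1/2:ℝ) 1) :
    StrictAntiOn
      (fun γ => if (wbar h γ)^2 ≤ 1 - wbar h γ then 1 - wbar h γ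
        else (1 - wbar h γ) * wbar h γ)
      (Ioo (0:ℝ) 1) := by
  intro a ha b hb hab
  obtain ⟨ha1, -⟩ := wbar_mem_Ioo hh ha
  obtain ⟨hb1, hb2⟩ := wbar_mem_Ioo hh hb
  have hw := wbar_strictMono hh.1 hab
  dsimp only
  generalize wbar h a = x at *
  generalize wbar h b = y at *
  split_ifs <;> nlinarith
end

section
/- Let μ₀ ∈ (0,1) and v_B ∈ [0,1). Then h ↦ p_low(h) is strictly decreasing on [1/2,1] and h ↦ ((1+2h)/4)·p_high(h) is strictly increasing on [1/2,1]. Moreover p_low(1/2) > (1/2)·p_high(1/2); hence if p_low(1) < (3/4)·p_high(1), there exists a unique h* ∈ (1/2,1) with p_low(h*) = ((1+2h*)/4)·p_high(h*), and the high-quality firm's equilibrium profit max( p_low(h), ((1+2h)/4)·p_high(h) ) is strictly decreasing in h on [1/2, h*] and strictly increasing in h on [h*, 1]. -/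
open Set

/-- Low pooling price (all naive consumers buy) under prior `μ₀`. -/
noncomputable def plow (μ0 vB h : ℝ) : ℝ :=
  (μ0 * (3 - 2*h) + (1 - μ0) * (1 + 2*h) * vB) / (μ0 * (3 - 2*h) + (1 - μ0) * (1 + 2*h))

/-- High pooling price (only good-signal consumers buy) under prior `μ₀`. -/
noncomputable def phigh (μ0 vB h : ℝ) : ℝ :=
  (μ0 * (1 + 2*h) + (1 - μ0) * (3 - 2*h) * vB) / (μ0 * (1 + 2*h) + (1 - μ0) * (3 - 2*h))

/-- The low price is the high price at the mirrored precision. -/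
lemma plow_eq_phigh_one_sub (μ0 vB h : ℝ) : plow μ0 vB h = phigh μ0 vB (1 - h) := by
  unfold plow phigh
  congr 1 <;> ring

lemma phigh_denom_pos {μ0 h : ℝ} (hμ : μ0 ∈ Ioo (0:ℝ) 1) (hh : h ∈ Icc (0:ℝ) 1) :
    0 < μ0 * (1 + 2*h) + (1 - μ0) * (3 - 2*h) :=
  add_pos (mul_pos hμ.1 (by linarith [hh.1]))
    (mul_pos (sub_pos.2 hμ.2) (by linarith [hh.2]))

lemma phigh_pos {μ0 vB h : ℝ} (hμ : μ0 ∈ Ioo (0:ℝ) 1) (hv : 0 ≤ vB)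
    (hh : h ∈ Icc (0:ℝ) 1) : 0 < phigh μ0 vB h :=
  div_pos
    (add_pos_of_pos_of_nonneg (mul_pos hμ.1 (by linarith [hh.1]))
      (mul_nonneg (mul_nonneg (sub_pos.2 hμ.2).le (by linarith [hh.2])) hv))
    (phigh_denom_pos hμ hh)

lemma phigh_strictMonoOn {μ0 vB : ℝ} (hμ : μ0 ∈ Ioo (0:ℝ) 1) (hv : vB < 1) :
    StrictMonoOn (phigh μ0 vB) (Icc 0 1) := by
  intro x hx y hy hxy
  unfold phigh
  rw [div_lt_div_iff₀ (phigh_denom_pos hμ hx) (phigh_denom_pos hμ hy)]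
  have key : 0 < (1 - vB) * μ0 * (1 - μ0) * (y - x) :=
    mul_pos (mul_pos (mul_pos (sub_pos.2 hv) hμ.1) (sub_pos.2 hμ.2)) (sub_pos.2 hxy)
  linear_combination 8 * key

lemma phigh_continuousOn {μ0 vB : ℝ} (hμ : μ0 ∈ Ioo (0:ℝ) 1) :
    ContinuousOn (phigh μ0 vB) (Icc 0 1) := by
  unfold phigh
  exact ContinuousOn.div (by fun_prop) (by fun_prop) fun h hh => (phigh_denom_pos hμ hh).ne'

lemma StrictAntiOn.max_of_crossing {f g : ℝ → ℝ} {a b c : ℝ} (hf : StrictAntiOn f (Icc a b))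
    (hg : StrictMonoOn g (Icc a b)) (hc : c ∈ Icc a b) (hfg : f c = g c) :
    StrictAntiOn (fun x => max (f x) (g x)) (Icc a c) := by
  intro x hx y hy hxy
  have hx' : x ∈ Icc a b := ⟨hx.1, hx.2.trans hc.2⟩
  have hy' : y ∈ Icc a b := ⟨hy.1, hy.2.trans hc.2⟩
  refine lt_max_of_lt_left (max_lt (hf hx' hy' hxy) ?_)
  calc g y ≤ g c := hg.monotoneOn hy' hc hy.2
    _ = f c := hfg.symm
    _ < f x := hf hx' hc (hxy.trans_le hy.2)

lemma StrictMonoOn.max_of_crossing {f g : ℝ → ℝ} {a b c : ℝ} (hf : StrictAntiOn f (Icc a b))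
    (hg : StrictMonoOn g (Icc a b)) (hc : c ∈ Icc a b) (hfg : f c = g c) :
    StrictMonoOn (fun x => max (f x) (g x)) (Icc c b) := by
  intro x hx y hy hxy
  have hx' : x ∈ Icc a b := ⟨hc.1.trans hx.1, hx.2⟩
  have hy' : y ∈ Icc a b := ⟨hc.1.trans hy.1, hy.2⟩
  refine lt_max_of_lt_right (max_lt ?_ (hg hx' hy' hxy))
  calc f x ≤ f c := hf.antitoneOn hc hx' hx.1
    _ = g c := hfg
    _ < g y := hg hc hy' (hx.1.trans_lt hxy)

/-- A strictly decreasing and a strictly increasing continuous function that swap order on an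
interval cross exactly once. -/
lemma existsUnique_crossing {f g : ℝ → ℝ} {a b : ℝ} (hab : a ≤ b)
    (hf : StrictAntiOn f (Icc a b)) (hg : StrictMonoOn g (Icc a b))
    (hfc : ContinuousOn f (Icc a b)) (hgc : ContinuousOn g (Icc a b))
    (ha : g a < f a) (hb : f b < g b) : ∃! c, c ∈ Ioo a b ∧ f c = g c := by
  obtain ⟨c, hc, hfg⟩ := intermediate_value_Ioo hab (hgc.sub hfc)
    (show (0:ℝ) ∈ Ioo (g a - f a) (g b - f b) from ⟨sub_neg.2 ha, sub_pos.2 hb⟩)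
  refine ⟨c, ⟨hc, (sub_eq_zero.1 hfg).symm⟩, fun d hd => ?_⟩
  have hmono : StrictMonoOn (fun x => g x - f x) (Icc a b) := fun x hx y hy hxy =>
    sub_lt_sub (hg hx hy hxy) (hf hx hy hxy)
  refine hmono.injOn (Ioo_subset_Icc_self hd.1) (Ioo_subset_Icc_self hc) ?_
  exact (sub_eq_zero.2 hd.2.symm).trans hfg.symm

/-- With a general prior `μ₀ ∈ (0,1)`: `p_low` is strictly decreasing and
`((1+2h)/4)·p_high(h)` strictly increasing on `[1/2,1]`, with
`p_low(1/2) > (1/2)·p_high(1/2)`; hence if `p_low(1) < (3/4)·p_high(1)` there is a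
unique crossing `h* ∈ (1/2,1)`, and the high-quality equilibrium profit
`max(p_low(h), ((1+2h)/4)·p_high(h))` is strictly decreasing on `[1/2, h*]` and
strictly increasing on `[h*, 1]`. -/
theorem stmt18 (μ0 vB : ℝ) (hμ : μ0 ∈ Ioo (0:ℝ) 1) (hv : vB ∈ Ico (0:ℝ) 1) :
    StrictAntiOn (plow μ0 vB) (Icc (1/2:ℝ) 1) ∧
    StrictMonoOn (fun h => ((1 + 2*h)/4) * phigh μ0 vB h) (Icc (1/2:ℝ) 1) ∧
    plow μ0 vB (1/2) > (1/2) * phigh μ0 vB (1/2) ∧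
    (plow μ0 vB 1 < (3/4) * phigh μ0 vB 1 →
      (∃! hstar : ℝ, hstar ∈ Ioo (1/2:ℝ) 1 ∧
        plow μ0 vB hstar = ((1 + 2*hstar)/4) * phigh μ0 vB hstar) ∧
      ∀ hstar ∈ Ioo (1/2:ℝ) 1,
        plow μ0 vB hstar = ((1 + 2*hstar)/4) * phigh μ0 vB hstar →
        StrictAntiOn (fun h => max (plow μ0 vB h) (((1 + 2*h)/4) * phigh μ0 vB h))
          (Icc (1/2:ℝ) hstar) ∧
        StrictMonoOn (fun h => max (plow μ0 vB h) (((1 + 2*h)/4) * phigh μ0 vB h))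
          (Icc hstar 1)) := by
  have hsub : Icc (1/2:ℝ) 1 ⊆ Icc 0 1 := Icc_subset_Icc_left (by norm_num)
  have hflip : MapsTo (fun h : ℝ => 1 - h) (Icc (1/2:ℝ) 1) (Icc 0 1) := fun h hh =>
    ⟨by linarith [hh.2], by linarith [hh.1]⟩
  have hlow : plow μ0 vB = fun h => phigh μ0 vB (1 - h) :=
    funext (plow_eq_phigh_one_sub μ0 vB)
  have hanti : StrictAntiOn (plow μ0 vB) (Icc (1/2:ℝ) 1) := by
    rw [hlow]
    exact fun x hx y hy hxy =>
      phigh_strictMonoOn hμ hv.2 (hflip hy) (hflip hx) (sub_lt_sub_left hxy 1)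
  have hmono : StrictMonoOn (fun h => ((1 + 2*h)/4) * phigh μ0 vB h) (Icc (1/2:ℝ) 1) :=
    fun x hx y hy hxy => mul_lt_mul'' (by linarith)
      (phigh_strictMonoOn hμ hv.2 (hsub hx) (hsub hy) hxy) (by linarith [hx.1])
      (phigh_pos hμ hv.1 (hsub hx)).le
  have hhalf : plow μ0 vB (1/2) > (1/2) * phigh μ0 vB (1/2) := by
    rw [plow_eq_phigh_one_sub, sub_half]
    linarith [phigh_pos (h := 1/2) hμ hv.1 (by norm_num)]
  have hlowc : ContinuousOn (plow μ0 vB) (Icc (1/2:ℝ) 1) := by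
    rw [hlow]
    exact (phigh_continuousOn hμ).comp (by fun_prop) hflip
  have hhighc : ContinuousOn (fun h => ((1 + 2*h)/4) * phigh μ0 vB h) (Icc (1/2:ℝ) 1) :=
    ContinuousOn.mul (by fun_prop) ((phigh_continuousOn hμ).mono hsub)
  refine ⟨hanti, hmono, hhalf, fun hone => ⟨?_, fun c hc hcross => ?_⟩⟩
  · refine existsUnique_crossing (by norm_num) hanti hmono hlowc hhighc ?_ ?_
    · convert hhalf using 2
      norm_num
    · convert hone using 2
      norm_num
  · have hc' := Ioo_subset_Icc_self hc
    exact ⟨hanti.max_of_crossing hmono hc' hcross,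
      StrictMonoOn.max_of_crossing hanti hmono hc' hcross⟩
end

section
/- Let μ₀ ∈ [1/2,1) and v_B ∈ [0,1). Then h ↦ ((3−2h)/4)·p_high(h) is strictly decreasing on [1/2,1]. Consequently, if h* ∈ (1/2,1) satisfies p_low(h*) = ((1+2h*)/4)·p_high(h*), then the low-quality firm's equilibrium profit, defined as p_low(h) for h ≤ h* and as ((3−2h)/4)·p_high(h) for h > h*, is strictly decreasing in h on [1/2,1]. -/
open Set

theorem plow_eq {μ0 vB h : ℝ} (hD : μ0 * (3 - 2*h) + (1 - μ0) * (1 + 2*h) ≠ 0) :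
    plow μ0 vB h =
      vB + (1 - vB) * (μ0 * (3 - 2*h) / (μ0 * (3 - 2*h) + (1 - μ0) * (1 + 2*h))) := by
  unfold plow
  rw [div_eq_iff hD, add_mul, mul_assoc (1 - vB), div_mul_cancel₀ _ hD]
  ring

theorem lowProfit_eq {μ0 vB h : ℝ} (hD : μ0 * (1 + 2*h) + (1 - μ0) * (3 - 2*h) ≠ 0) :
    ((3 - 2*h)/4) * phigh μ0 vB h =
      vB * ((3 - 2*h)/4) + (1 - vB) * μ0 / 4 *
        ((3 - 2*h) * (1 + 2*h) / (μ0 * (1 + 2*h) + (1 - μ0) * (3 - 2*h))) := by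
  unfold phigh
  rw [mul_div_assoc', div_eq_iff hD, add_mul, mul_assoc (_ / 4) (_ / _), div_mul_cancel₀ _ hD]
  ring

theorem strictAntiOn_plow {μ0 vB : ℝ} (hμ : μ0 ∈ Ioo (0:ℝ) 1) (hv : vB < 1) :
    StrictAntiOn (plow μ0 vB) (Icc (1/2:ℝ) 1) := by
  rintro a ⟨ha, ha'⟩ b ⟨hb, hb'⟩ hab
  obtain ⟨h0, h1⟩ := hμ
  have hD : ∀ h : ℝ, 1/2 ≤ h → h ≤ 1 → 0 < μ0 * (3 - 2*h) + (1 - μ0) * (1 + 2*h) :=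
    fun h _ _ => add_pos (mul_pos h0 (by linarith)) (mul_pos (by linarith) (by linarith))
  rw [plow_eq (hD a ha ha').ne', plow_eq (hD b hb hb').ne']
  refine add_lt_add_right (mul_lt_mul_of_pos_left ?_ (sub_pos.2 hv)) _
  rw [div_lt_div_iff₀ (hD b hb hb') (hD a ha ha')]
  have : 0 < μ0 * (1 - μ0) * (b - a) :=
    mul_pos (mul_pos h0 (by linarith)) (by linarith)
  nlinarith

theorem strictAntiOn_lowProfit {μ0 vB : ℝ} (hμ : μ0 ∈ Ico (1/2:ℝ) 1)
    (hv : vB ∈ Ico (0:ℝ) 1) :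
    StrictAntiOn (fun h => ((3 - 2*h)/4) * phigh μ0 vB h) (Icc (1/2:ℝ) 1) := by
  rintro a ⟨ha, ha'⟩ b ⟨hb, hb'⟩ hab
  obtain ⟨h0, h1⟩ := hμ
  obtain ⟨hv0, hv1⟩ := hv
  have hD : ∀ h : ℝ, 1/2 ≤ h → h ≤ 1 → 0 < μ0 * (1 + 2*h) + (1 - μ0) * (3 - 2*h) :=
    fun h _ _ =>
      add_pos (mul_pos (by linarith) (by linarith)) (mul_pos (by linarith) (by linarith))
  beta_reduce
  rw [lowProfit_eq (hD a ha ha').ne', lowProfit_eq (hD b hb hb').ne']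
  refine add_lt_add_of_le_of_lt (mul_le_mul_of_nonneg_left (by linarith) hv0)
    (mul_lt_mul_of_pos_left ?_ (div_pos (mul_pos (by linarith) (by linarith)) four_pos))
  rw [div_lt_div_iff₀ (hD b hb hb') (hD a ha ha')]
  have hpq : (3 - 2*a) * (3 - 2*b) < (1 + 2*a) * (1 + 2*b) := by nlinarith
  have hq : 0 < (3 - 2*a) * (3 - 2*b) := mul_pos (by linarith) (by linarith)
  have key : 0 < μ0 * ((1 + 2*a) * (1 + 2*b)) - (1 - μ0) * ((3 - 2*a) * (3 - 2*b)) := by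
    nlinarith
  have := mul_pos (sub_pos.2 hab) key
  linear_combination 2 * this

theorem phigh_nonneg {μ0 vB h : ℝ} (hμ : μ0 ∈ Icc (0:ℝ) 1) (hv : 0 ≤ vB)
    (hh : h ∈ Icc (1/2:ℝ) 1) : 0 ≤ phigh μ0 vB h := by
  obtain ⟨h0, h1⟩ := hμ
  obtain ⟨ha, hb⟩ := hh
  have hp : 0 ≤ 1 + 2*h := by linarith
  have hq : 0 ≤ 3 - 2*h := by linarith
  have hm : 0 ≤ 1 - μ0 := by linarith
  unfold phigh
  positivity

/-- For `μ₀ ∈ [1/2, 1)` and `v_B ∈ [0,1)`, `((3−2h)/4)·p_high(h)` is strictly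
decreasing on `[1/2,1]`; hence if `h* ∈ (1/2,1)` satisfies
`p_low(h*) = ((1+2h*)/4)·p_high(h*)`, the low-quality equilibrium profit — `p_low(h)`
for `h ≤ h*` and `((3−2h)/4)·p_high(h)` for `h > h*` — is strictly decreasing on
`[1/2,1]`. -/
theorem stmt19 (μ0 vB : ℝ) (hμ : μ0 ∈ Ico (1/2:ℝ) 1) (hv : vB ∈ Ico (0:ℝ) 1) :
    StrictAntiOn (fun h => ((3 - 2*h)/4) * phigh μ0 vB h) (Icc (1/2:ℝ) 1) ∧
    ∀ hstar ∈ Ioo (1/2:ℝ) 1,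
      plow μ0 vB hstar = ((1 + 2*hstar)/4) * phigh μ0 vB hstar →
      StrictAntiOn (fun h => if h ≤ hstar then plow μ0 vB h else ((3 - 2*h)/4) * phigh μ0 vB h)
        (Icc (1/2:ℝ) 1) := by
  have hlow := strictAntiOn_plow (vB := vB) ⟨by linarith [hμ.1], hμ.2⟩ hv.2
  have hhigh := strictAntiOn_lowProfit hμ hv
  refine ⟨hhigh, fun s hs heq a ha b hb hab => ?_⟩
  have hs' : s ∈ Icc (1/2:ℝ) 1 := Ioo_subset_Icc_self hs
  beta_reduce
  split_ifs with hbs has has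
  · exact hlow ha hb hab
  · exact absurd (hab.le.trans hbs) has
  · calc ((3 - 2*b)/4) * phigh μ0 vB b
        < ((3 - 2*s)/4) * phigh μ0 vB s := hhigh hs' hb (not_le.1 hbs)
      _ ≤ ((1 + 2*s)/4) * phigh μ0 vB s :=
        mul_le_mul_of_nonneg_right (by linarith [hs.1])
          (phigh_nonneg ⟨by linarith [hμ.1], hμ.2.le⟩ hv.1 hs')
      _ = plow μ0 vB s := heq.symm
      _ ≤ plow μ0 vB a := hlow.antitoneOn ha hs' has
  · exact hhigh ha hb hab
end
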